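/- arXiv:2012.04356 — 4 statements merged into one kernel-verified Lean document; each statement's English description precedes it below -/
import Mathlib

section
/- Let n > 2 be a real number. There exists a constant C < ∞ depending only on n such that for all ε ∈ (0,1) and all r ∈ ℝ one has H_ε(r)² ≤ C G_ε(r). -/
open MeasureTheory

/-- `F_ε(r) = (r² + ε²)^(n/4)` -/
noncomputable def Feps (n ε r : ℝ) : ℝ := (r ^ 2 + ε ^ 2) ^ (n / 4)

/-- `G_ε(r) = ∫_r^∞ ∫_{r'}^∞ (r''² + ε²)^(-n/2) dr'' dr'` -/
noncomputable def Geps (n ε r : ℝ) : ℝ :=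
  ∫ r' in Set.Ioi r, ∫ r'' in Set.Ioi r', (r'' ^ 2 + ε ^ 2) ^ (-(n / 2))

/-- `H_ε(r) = ∫_r^∞ (r'² + ε²)^(-n/4) dr'` -/
noncomputable def Heps (n ε r : ℝ) : ℝ :=
  ∫ r' in Set.Ioi r, (r' ^ 2 + ε ^ 2) ^ (-(n / 4))

theorem integral_Ioi_add_rpow {a ε r : ℝ} (ha : a < -1) (h : 0 < r + ε) :
    ∫ s in Set.Ioi r, (s + ε) ^ a = -(r + ε) ^ (a + 1) / (a + 1) := by
  rw [← integral_Ioi_rpow_of_lt ha h]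
  have h' := (measurePreserving_add_right volume ε).setIntegral_preimage_emb
    (measurableEmbedding_addRight ε) (fun s : ℝ => s ^ a) (Set.Ioi (r + ε))
  rwa [Set.preimage_add_const_Ioi, add_sub_cancel_right] at h'

theorem integrable_sq_add_sq_rpow {ε p : ℝ} (hε : ε ∈ Set.Ioo (0 : ℝ) 1) (hp : 1 < 2 * p) :
    Integrable (fun s : ℝ => (s ^ 2 + ε ^ 2) ^ (-p)) := by
  obtain ⟨h0, h1⟩ := hε
  have hbase : ∀ s : ℝ, 0 < s ^ 2 + ε ^ 2 := fun s => by positivity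
  have hI : Integrable (fun s : ℝ => (1 + ‖s‖ ^ 2) ^ (-(2 * p) / 2)) :=
    integrable_rpow_neg_one_add_norm_sq (by simpa using hp)
  refine (hI.const_mul ((ε ^ 2) ^ (-p))).mono'
    (Continuous.aestronglyMeasurable ?_) (Filter.Eventually.of_forall fun s => ?_)
  · exact Continuous.rpow_const (by fun_prop) fun s => Or.inl (hbase s).ne'
  · rw [Real.norm_of_nonneg (Real.rpow_nonneg (hbase s).le _),
      show -(2 * p) / 2 = -p by ring, ← Real.mul_rpow (by positivity) (by positivity)]
    refine Real.rpow_le_rpow_of_nonpos (by positivity) ?_ (by linarith)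
    rw [Real.norm_eq_abs, sq_abs]
    nlinarith [mul_nonneg (sq_nonneg s) (show 0 ≤ 1 - ε ^ 2 by nlinarith)]

theorem add_rpow_le_sq_add_sq_rpow {ε s p : ℝ} (hε : 0 < ε) (hs : 0 ≤ s) (hp : 0 ≤ p) :
    (s + ε) ^ (-(2 * p)) ≤ (s ^ 2 + ε ^ 2) ^ (-p) := by
  have h : (s + ε) ^ (-(2 * p)) = ((s + ε) ^ 2) ^ (-p) := by
    rw [← Real.rpow_natCast, ← Real.rpow_mul (by positivity)]
    congr 1
    push_cast
    ring
  rw [h]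
  exact Real.rpow_le_rpow_of_nonpos (by positivity) (by nlinarith) (by linarith)

theorem sq_add_sq_rpow_le_add_rpow {ε s p : ℝ} (hε : 0 < ε) (hs : 0 ≤ s) (hp : 0 ≤ p) :
    (s ^ 2 + ε ^ 2) ^ (-p) ≤ 2 ^ p * (s + ε) ^ (-(2 * p)) := by
  have h : 2 ^ p * (s + ε) ^ (-(2 * p)) = ((s + ε) ^ 2 / 2) ^ (-p) := by
    rw [Real.div_rpow (by positivity) (by positivity), ← Real.rpow_natCast,
      ← Real.rpow_mul (by positivity), Real.rpow_neg (by norm_num : (0 : ℝ) ≤ 2), div_inv_eq_mul,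
      mul_comm]
    congr 2
    push_cast
    ring
  rw [h]
  exact Real.rpow_le_rpow_of_nonpos (by positivity) (by nlinarith [sq_nonneg (s - ε)])
    (by linarith)

theorem integral_Ioi_sq_add_sq_rpow_le {ε r p : ℝ} (hε : ε ∈ Set.Ioo (0 : ℝ) 1) (hr : 0 ≤ r)
    (hp : 1 < 2 * p) :
    ∫ s in Set.Ioi r, (s ^ 2 + ε ^ 2) ^ (-p) ≤
      2 ^ p * ((r + ε) ^ (1 - 2 * p) / (2 * p - 1)) := by
  have h0 := hε.1
  calc ∫ s in Set.Ioi r, (s ^ 2 + ε ^ 2) ^ (-p)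
      ≤ ∫ s in Set.Ioi r, 2 ^ p * (s + ε) ^ (-(2 * p)) :=
        setIntegral_mono_on (integrable_sq_add_sq_rpow hε hp).integrableOn
          ((integrableOn_add_rpow_Ioi_of_lt (by linarith) (by linarith)).const_mul _)
          measurableSet_Ioi fun s hs =>
            sq_add_sq_rpow_le_add_rpow h0 (hr.trans (Set.mem_Ioi.mp hs).le) (by linarith)
    _ = 2 ^ p * ((r + ε) ^ (1 - 2 * p) / (2 * p - 1)) := by
        rw [integral_const_mul, integral_Ioi_add_rpow (by linarith) (by linarith),
          show -(2 * p) + 1 = 1 - 2 * p by ring, neg_div, ← div_neg, neg_sub]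

theorem le_integral_Ioi_sq_add_sq_rpow {ε r p : ℝ} (hε : ε ∈ Set.Ioo (0 : ℝ) 1) (hr : 0 ≤ r)
    (hp : 1 < 2 * p) :
    (r + ε) ^ (1 - 2 * p) / (2 * p - 1) ≤ ∫ s in Set.Ioi r, (s ^ 2 + ε ^ 2) ^ (-p) := by
  have h0 := hε.1
  calc (r + ε) ^ (1 - 2 * p) / (2 * p - 1) = ∫ s in Set.Ioi r, (s + ε) ^ (-(2 * p)) := by
        rw [integral_Ioi_add_rpow (by linarith) (by linarith),
          show -(2 * p) + 1 = 1 - 2 * p by ring, neg_div, ← div_neg, neg_sub]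
    _ ≤ ∫ s in Set.Ioi r, (s ^ 2 + ε ^ 2) ^ (-p) :=
        setIntegral_mono_on (integrableOn_add_rpow_Ioi_of_lt (by linarith) (by linarith))
          (integrable_sq_add_sq_rpow hε hp).integrableOn
          measurableSet_Ioi fun s hs =>
            add_rpow_le_sq_add_sq_rpow h0 (hr.trans (Set.mem_Ioi.mp hs).le) (by linarith)

theorem antitone_integral_Ioi {f : ℝ → ℝ} (hf : Integrable f) (h : 0 ≤ f) :
    Antitone fun r => ∫ s in Set.Ioi r, f s := fun _ _ hab =>
  setIntegral_mono_set hf.integrableOn (Filter.Eventually.of_forall h)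
    (Set.Ioi_subset_Ioi hab).eventuallyLE

theorem integrableOn_integral_Ioi_sq_add_sq_rpow {ε p : ℝ} (hε : ε ∈ Set.Ioo (0 : ℝ) 1)
    (hp : 1 < p) (r : ℝ) :
    IntegrableOn (fun t => ∫ s in Set.Ioi t, (s ^ 2 + ε ^ 2) ^ (-p)) (Set.Ioi r) := by
  have h0 := hε.1
  have hanti := antitone_integral_Ioi
    (integrable_sq_add_sq_rpow (p := p) hε (by linarith)) fun s => by positivity
  have hpos : IntegrableOn (fun t => ∫ s in Set.Ioi t, (s ^ 2 + ε ^ 2) ^ (-p)) (Set.Ioi 0) := by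
    have hI : IntegrableOn (fun t : ℝ => 2 ^ p * ((t + ε) ^ (1 - 2 * p) / (2 * p - 1)))
        (Set.Ioi 0) :=
      ((integrableOn_add_rpow_Ioi_of_lt (by linarith) (by linarith)).div_const _).const_mul _
    refine hI.mono' hanti.measurable.aestronglyMeasurable ?_
    refine (ae_restrict_mem measurableSet_Ioi).mono fun t ht => ?_
    rw [Real.norm_of_nonneg (integral_nonneg fun s => by positivity)]
    exact integral_Ioi_sq_add_sq_rpow_le hε (Set.mem_Ioi.mp ht).le (by linarith)
  refine (((hanti.antitoneOn _).integrableOn_isCompact (isCompact_Icc (a := r) (b := 0))).union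
    hpos).mono_set fun t ht => ?_
  rcases le_or_gt t 0 with h | h
  · exact Or.inl ⟨(Set.mem_Ioi.mp ht).le, h⟩
  · exact Or.inr h

theorem Geps_anti {n ε : ℝ} (hn : 2 < n) (hε : ε ∈ Set.Ioo (0 : ℝ) 1) : Antitone (Geps n ε) :=
  fun a _ hab => setIntegral_mono_set
    (integrableOn_integral_Ioi_sq_add_sq_rpow hε (by linarith) a)
    (Filter.Eventually.of_forall fun _ => integral_nonneg fun s => by have := hε.1; positivity)
    (Set.Ioi_subset_Ioi hab).eventuallyLE

theorem le_Geps {n ε r : ℝ} (hn : 2 < n) (hε : ε ∈ Set.Ioo (0 : ℝ) 1) (hr : 0 ≤ r) :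
    (r + ε) ^ (2 - n) / ((n - 1) * (n - 2)) ≤ Geps n ε r := by
  have h0 := hε.1
  calc (r + ε) ^ (2 - n) / ((n - 1) * (n - 2))
      = ∫ t in Set.Ioi r, (t + ε) ^ (1 - n) / (n - 1) := by
        rw [integral_div, integral_Ioi_add_rpow (by linarith) (by linarith),
          show 1 - n + 1 = 2 - n by ring, neg_div, ← div_neg, neg_sub, div_div,
          mul_comm (n - 1)]
    _ ≤ Geps n ε r := by
        refine setIntegral_mono_on
          ((integrableOn_add_rpow_Ioi_of_lt (by linarith) (by linarith)).div_const _)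
          (integrableOn_integral_Ioi_sq_add_sq_rpow hε (by linarith) r)
          measurableSet_Ioi fun t ht => ?_
        have := le_integral_Ioi_sq_add_sq_rpow (p := n / 2) hε
          (hr.trans (Set.mem_Ioi.mp ht).le) (by linarith)
        rwa [mul_div_cancel₀ n two_ne_zero] at this

theorem Heps_nonneg {n ε : ℝ} (r : ℝ) : 0 ≤ Heps n ε r :=
  integral_nonneg fun s => by positivity

theorem Heps_le_two_mul {n ε : ℝ} (hn : 2 < n) (hε : ε ∈ Set.Ioo (0 : ℝ) 1) (r : ℝ) :
    Heps n ε r ≤ 2 * Heps n ε 0 := by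
  have h := integral_comp_abs (f := fun s : ℝ => (s ^ 2 + ε ^ 2) ^ (-(n / 4)))
  simp only [sq_abs] at h
  calc Heps n ε r ≤ ∫ s : ℝ, (s ^ 2 + ε ^ 2) ^ (-(n / 4)) :=
        setIntegral_le_integral (integrable_sq_add_sq_rpow hε (by linarith))
          (Filter.Eventually.of_forall fun s => by positivity)
    _ = 2 * Heps n ε 0 := h

theorem Heps_sq_le_of_nonneg {n ε r : ℝ} (hn : 2 < n) (hε : ε ∈ Set.Ioo (0 : ℝ) 1) (hr : 0 ≤ r) :
    (Heps n ε r) ^ 2 ≤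
      (2 ^ (n / 4) / (n / 2 - 1)) ^ 2 * ((n - 1) * (n - 2)) * Geps n ε r := by
  have h0 := hε.1
  have hH : Heps n ε r ≤ 2 ^ (n / 4) * ((r + ε) ^ (1 - 2 * (n / 4)) / (2 * (n / 4) - 1)) :=
    integral_Ioi_sq_add_sq_rpow_le hε hr (by linarith)
  have hm : ((r + ε) ^ (1 - 2 * (n / 4))) ^ 2 = (r + ε) ^ (2 - n) := by
    rw [← Real.rpow_natCast, ← Real.rpow_mul (by positivity)]
    congr 1
    push_cast
    ring
  have hc : 0 < (n - 1) * (n - 2) := mul_pos (by linarith) (by linarith)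
  have hG := (div_le_iff₀ hc).mp (le_Geps hn hε hr)
  calc (Heps n ε r) ^ 2
      ≤ (2 ^ (n / 4) * ((r + ε) ^ (1 - 2 * (n / 4)) / (2 * (n / 4) - 1))) ^ 2 :=
        pow_le_pow_left₀ (Heps_nonneg r) hH 2
    _ = (2 ^ (n / 4) / (n / 2 - 1)) ^ 2 * (r + ε) ^ (2 - n) := by
        rw [← hm, show 2 * (n / 4) - 1 = n / 2 - 1 by ring]
        ring
    _ ≤ (2 ^ (n / 4) / (n / 2 - 1)) ^ 2 * (Geps n ε r * ((n - 1) * (n - 2))) := by gcongr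
    _ = _ := by ring

/-- There is a constant `C` depending only on `n > 2` such that for all `ε ∈ (0,1)`
and all `r`, `H_ε(r)² ≤ C G_ε(r)`. -/
theorem Heps_sq_le (n : ℝ) (hn : 2 < n) :
    ∃ C : ℝ, ∀ ε ∈ Set.Ioo (0 : ℝ) 1, ∀ r : ℝ,
      (Heps n ε r) ^ 2 ≤ C * Geps n ε r := by
  set K : ℝ := (2 ^ (n / 4) / (n / 2 - 1)) ^ 2 * ((n - 1) * (n - 2)) with hK
  have hK0 : 0 ≤ K :=
    mul_nonneg (sq_nonneg _) (mul_nonneg (by linarith) (by linarith))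
  refine ⟨4 * K, fun ε hε r => ?_⟩
  rcases le_total 0 r with hr | hr
  · have h := Heps_sq_le_of_nonneg hn hε hr
    rw [← hK] at h
    nlinarith [sq_nonneg (Heps n ε r)]
  · calc (Heps n ε r) ^ 2 ≤ (2 * Heps n ε 0) ^ 2 :=
          pow_le_pow_left₀ (Heps_nonneg r) (Heps_le_two_mul hn hε r) 2
      _ = 4 * (Heps n ε 0) ^ 2 := by ring
      _ ≤ 4 * (K * Geps n ε 0) := by
          gcongr
          exact Heps_sq_le_of_nonneg hn hε le_rfl
      _ ≤ 4 * (K * Geps n ε r) := by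
          gcongr
          exact Geps_anti hn hε hr
      _ = 4 * K * Geps n ε r := by ring
end

section
/- Let n = 3. For every ϑ > 0 there exists a constant C < ∞ depending only on ϑ such that for all ε ∈ (0,1) and all r ∈ ℝ one has |∫_1^r (F_ε''(s))² ds| ≤ C (1 + |r|^{ϑ} + G_ε(r)^{ϑ}), where F_ε'' denotes the second derivative of F_ε. -/
open MeasureTheory

open Filter Topology

lemma sqrt_sq_add_sq_add_pos {ε : ℝ} (hε : 0 < ε) (s : ℝ) : 0 < √(s ^ 2 + ε ^ 2) + s := by
  have h : |s| < √(s ^ 2 + ε ^ 2) := by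
    rw [← Real.sqrt_sq_eq_abs]
    exact Real.sqrt_lt_sqrt (sq_nonneg s) (by nlinarith)
  linarith [neg_abs_le s]

lemma hasDerivAt_sqrt_sq_add_sq {ε : ℝ} (hε : 0 < ε) (s : ℝ) :
    HasDerivAt (fun s : ℝ => √(s ^ 2 + ε ^ 2)) (s / √(s ^ 2 + ε ^ 2)) s := by
  have h : HasDerivAt (fun s : ℝ => s ^ 2 + ε ^ 2) (2 * s) s := by
    simpa using (hasDerivAt_pow 2 s).add_const (ε ^ 2)
  convert h.sqrt (by positivity) using 1
  field_simp

lemma tendsto_sqrt_sq_add_sq_add_atTop (ε : ℝ) :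
    Tendsto (fun s : ℝ => √(s ^ 2 + ε ^ 2) + s) atTop atTop :=
  tendsto_atTop_mono (fun _ => le_add_of_nonneg_left (Real.sqrt_nonneg _)) tendsto_id

lemma tendsto_sqrt_sq_add_sq_atTop (ε : ℝ) :
    Tendsto (fun s : ℝ => √(s ^ 2 + ε ^ 2)) atTop atTop :=
  tendsto_atTop_mono
    (fun s => (le_abs_self s).trans (Real.abs_le_sqrt (by nlinarith [sq_nonneg ε]))) tendsto_id

lemma integral_Ioi_rpow_sq_add_sq {ε : ℝ} (hε : 0 < ε) (r : ℝ) :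
    ∫ s in Set.Ioi r, (s ^ 2 + ε ^ 2) ^ (-((3 : ℝ) / 2)) =
      (√(r ^ 2 + ε ^ 2) * (√(r ^ 2 + ε ^ 2) + r))⁻¹ := by
  have hd : ∀ s ∈ Set.Ici r, HasDerivAt
      (fun s : ℝ => -(√(s ^ 2 + ε ^ 2) * (√(s ^ 2 + ε ^ 2) + s))⁻¹)
      ((s ^ 2 + ε ^ 2) ^ (-((3 : ℝ) / 2))) s := by
    intro s _
    have hq := hasDerivAt_sqrt_sq_add_sq hε s
    have hpos := sqrt_sq_add_sq_add_pos hε s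
    have hq0 : 0 < √(s ^ 2 + ε ^ 2) := by positivity
    have hpow : (s ^ 2 + ε ^ 2) ^ (-((3 : ℝ) / 2)) = (√(s ^ 2 + ε ^ 2) ^ 3)⁻¹ := by
      rw [Real.rpow_neg (by positivity), Real.sqrt_eq_rpow, ← Real.rpow_mul_natCast (by positivity)]
      norm_num
    rw [hpow]
    refine ((hq.fun_mul (hq.fun_add (hasDerivAt_id' s))).fun_inv (mul_pos hq0 hpos).ne').fun_neg.congr_deriv ?_
    generalize √(s ^ 2 + ε ^ 2) = q at *
    have h1 := hpos.ne'
    field_simp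
    ring
  have hlim : Tendsto (fun s : ℝ => -(√(s ^ 2 + ε ^ 2) * (√(s ^ 2 + ε ^ 2) + s))⁻¹)
      atTop (𝓝 0) := by
    simpa using (tendsto_inv_atTop_zero.comp
      ((tendsto_sqrt_sq_add_sq_atTop ε).atTop_mul_atTop₀
        (tendsto_sqrt_sq_add_sq_add_atTop ε))).neg
  rw [integral_Ioi_of_hasDerivAt_of_nonneg' hd (fun s _ => by positivity) hlim]
  simp

/-- For `n = 3` the iterated integral is explicit. -/
lemma Geps_three {ε : ℝ} (hε : 0 < ε) (r : ℝ) :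
    Geps 3 ε r = (√(r ^ 2 + ε ^ 2) + r)⁻¹ := by
  have hd : ∀ s ∈ Set.Ici r, HasDerivAt (fun s : ℝ => -(√(s ^ 2 + ε ^ 2) + s)⁻¹)
      ((√(s ^ 2 + ε ^ 2) * (√(s ^ 2 + ε ^ 2) + s))⁻¹) s := by
    intro s _
    have hq := hasDerivAt_sqrt_sq_add_sq hε s
    have hpos := sqrt_sq_add_sq_add_pos hε s
    have hq0 : 0 < √(s ^ 2 + ε ^ 2) := by positivity
    refine ((hq.fun_add (hasDerivAt_id' s)).fun_inv hpos.ne').fun_neg.congr_deriv ?_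
    generalize √(s ^ 2 + ε ^ 2) = q at *
    have h1 := hpos.ne'
    field_simp
    ring
  have hlim : Tendsto (fun s : ℝ => -(√(s ^ 2 + ε ^ 2) + s)⁻¹) atTop (𝓝 0) := by
    simpa using (tendsto_inv_atTop_zero.comp (tendsto_sqrt_sq_add_sq_add_atTop ε)).neg
  unfold Geps
  simp_rw [integral_Ioi_rpow_sq_add_sq hε]
  rw [integral_Ioi_of_hasDerivAt_of_nonneg' hd (fun s _ => ?_) hlim]
  · simp
  · have := sqrt_sq_add_sq_add_pos hε s
    positivity

lemma iteratedDeriv_two_Feps_three {ε : ℝ} (hε : 0 < ε) (s : ℝ) :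
    iteratedDeriv 2 (Feps 3 ε) s =
      (s ^ 2 + ε ^ 2) ^ (-(1 / 4) : ℝ) * (3 / 2 - 3 / 4 * (s ^ 2 / (s ^ 2 + ε ^ 2))) := by
  have h (s : ℝ) : HasDerivAt (fun s : ℝ => s ^ 2 + ε ^ 2) (2 * s) s := by
    simpa using (hasDerivAt_pow 2 s).add_const (ε ^ 2)
  have h0 (s : ℝ) : 0 < s ^ 2 + ε ^ 2 := by positivity
  have hF : deriv (Feps 3 ε) = fun s => 3 / 2 * s * (s ^ 2 + ε ^ 2) ^ (-(1 / 4) : ℝ) := by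
    funext s
    have := (h s).rpow_const (p := 3 / 4) (Or.inl (h0 s).ne')
    refine HasDerivAt.deriv (HasDerivAt.congr_deriv this ?_)
    rw [show (3 / 4 - 1 : ℝ) = -(1 / 4) by norm_num]
    ring
  rw [iteratedDeriv_succ, iteratedDeriv_one, hF]
  have := ((hasDerivAt_id' s).const_mul (3 / 2 : ℝ)).mul
    ((h s).rpow_const (p := -(1 / 4)) (Or.inl (h0 s).ne'))
  refine HasDerivAt.deriv (HasDerivAt.congr_deriv this ?_)
  rw [Real.rpow_sub_one (h0 s).ne']
  have := (h0 s).ne'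
  field_simp
  ring

lemma sq_iteratedDeriv_two_Feps_three_le {ε : ℝ} (hε : 0 < ε) (s : ℝ) :
    (iteratedDeriv 2 (Feps 3 ε) s) ^ 2 ≤ 9 / 4 * (√(s ^ 2 + ε ^ 2))⁻¹ := by
  have h0 : 0 < s ^ 2 + ε ^ 2 := by positivity
  have hpow : ((s ^ 2 + ε ^ 2) ^ (-(1 / 4) : ℝ)) ^ 2 = (√(s ^ 2 + ε ^ 2))⁻¹ := by
    rw [Real.sqrt_eq_rpow, ← Real.rpow_neg h0.le, ← Real.rpow_mul_natCast h0.le]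
    norm_num
  have hx0 : 0 ≤ s ^ 2 / (s ^ 2 + ε ^ 2) := by positivity
  have hx1 : s ^ 2 / (s ^ 2 + ε ^ 2) ≤ 1 := by
    rw [div_le_one h0]
    nlinarith
  rw [iteratedDeriv_two_Feps_three hε, mul_pow, hpow, mul_comm]
  gcongr
  nlinarith

lemma hasDerivAt_log_sqrt_sq_add_sq_add {ε : ℝ} (hε : 0 < ε) (s : ℝ) :
    HasDerivAt (fun s : ℝ => Real.log (√(s ^ 2 + ε ^ 2) + s)) (√(s ^ 2 + ε ^ 2))⁻¹ s := by
  have hpos := sqrt_sq_add_sq_add_pos hε s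
  have hq0 : 0 < √(s ^ 2 + ε ^ 2) := by positivity
  refine (((hasDerivAt_sqrt_sq_add_sq hε s).fun_add (hasDerivAt_id' s)).log
    hpos.ne').congr_deriv ?_
  generalize √(s ^ 2 + ε ^ 2) = q at *
  have h1 := hpos.ne'
  field_simp
  ring

lemma abs_integral_sq_iteratedDeriv_two_Feps_three_le {ε : ℝ} (hε : 0 < ε) (r : ℝ) :
    |∫ s in (1 : ℝ)..r, (iteratedDeriv 2 (Feps 3 ε) s) ^ 2| ≤
      9 / 4 * |Real.log (√(r ^ 2 + ε ^ 2) + r) - Real.log (√(1 ^ 2 + ε ^ 2) + 1)| := by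
  have hint : IntervalIntegrable (fun s : ℝ => (√(s ^ 2 + ε ^ 2))⁻¹) volume 1 r := by
    refine Continuous.intervalIntegrable (Continuous.inv₀ (by fun_prop) fun s => ?_) 1 r
    positivity
  have h := intervalIntegral.norm_integral_le_abs_of_norm_le
    (f := fun s => (iteratedDeriv 2 (Feps 3 ε) s) ^ 2)
    (ae_of_all _ fun s => by
      rw [Real.norm_of_nonneg (sq_nonneg _)]
      exact sq_iteratedDeriv_two_Feps_three_le hε s) (hint.const_mul (9 / 4))
  rwa [intervalIntegral.integral_const_mul,
    intervalIntegral.integral_eq_sub_of_hasDerivAt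
      (fun s _ => hasDerivAt_log_sqrt_sq_add_sq_add hε s) hint,
    abs_mul, abs_of_pos (by norm_num : (0 : ℝ) < 9 / 4), Real.norm_eq_abs] at h

lemma abs_log_sqrt_sq_add_sq_add_le {ε ϑ : ℝ} (hε : ε ∈ Set.Ioo (0 : ℝ) 1) (hϑ : 0 < ϑ)
    (r : ℝ) :
    |Real.log (√(r ^ 2 + ε ^ 2) + r)| ≤
      3 ^ ϑ / ϑ * (1 + |r| ^ ϑ + ((√(r ^ 2 + ε ^ 2) + r)⁻¹) ^ ϑ) := by
  have hpos := sqrt_sq_add_sq_add_pos hε.1 r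
  have hle : √(r ^ 2 + ε ^ 2) ≤ |r| + 1 := by
    rw [Real.sqrt_le_left (by positivity)]
    nlinarith [sq_abs r, abs_nonneg r, hε.1, hε.2]
  have hle3 : √(r ^ 2 + ε ^ 2) + r ≤ 3 * max 1 |r| := by
    linarith [le_abs_self r, le_max_left 1 |r|, le_max_right 1 |r|]
  have hr : 0 ≤ |r| ^ ϑ := by positivity
  set x := √(r ^ 2 + ε ^ 2) + r
  have hx : 0 ≤ (x⁻¹) ^ ϑ := by positivity
  have h3 : (1 : ℝ) ≤ 3 ^ ϑ := Real.one_le_rpow (by norm_num) hϑ.le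
  have hmax : (max 1 |r|) ^ ϑ ≤ 1 + |r| ^ ϑ := by
    rcases max_choice 1 |r| with h | h <;> rw [h]
    · simpa using hr
    · linarith
  have hlog : Real.log x ≤ 3 ^ ϑ / ϑ * (1 + |r| ^ ϑ) := calc
    Real.log x ≤ x ^ ϑ / ϑ := Real.log_le_rpow_div hpos.le hϑ
    _ ≤ (3 * max 1 |r|) ^ ϑ / ϑ := by gcongr
    _ = 3 ^ ϑ / ϑ * (max 1 |r|) ^ ϑ := by
      rw [Real.mul_rpow (by norm_num) (by positivity)]
      ring
    _ ≤ _ := by gcongr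
  have hlog' : -Real.log x ≤ 3 ^ ϑ / ϑ * (x⁻¹) ^ ϑ := calc
    -Real.log x = Real.log x⁻¹ := (Real.log_inv x).symm
    _ ≤ (x⁻¹) ^ ϑ / ϑ := Real.log_le_rpow_div (by positivity) hϑ
    _ = 1 / ϑ * (x⁻¹) ^ ϑ := by ring
    _ ≤ _ := by gcongr
  have hA : 0 ≤ 3 ^ ϑ / ϑ * (1 + |r| ^ ϑ) := by positivity
  have hB : 0 ≤ 3 ^ ϑ / ϑ * (x⁻¹) ^ ϑ := by positivity
  rw [mul_add, abs_le']
  constructor <;> linarith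

/-- For `n = 3`: for every `ϑ > 0` there is a constant `C` depending only on `ϑ`
such that for all `ε ∈ (0,1)` and all `r`,
`|∫_1^r (F_ε''(s))² ds| ≤ C (1 + |r|^ϑ + G_ε(r)^ϑ)`. -/
theorem int_Feps_second_deriv_sq_le_n_eq_three (ϑ : ℝ) (hϑ : 0 < ϑ) :
    ∃ C : ℝ, ∀ ε ∈ Set.Ioo (0 : ℝ) 1, ∀ r : ℝ,
      |∫ s in (1 : ℝ)..r, (iteratedDeriv 2 (Feps 3 ε) s) ^ 2|
        ≤ C * (1 + |r| ^ ϑ + (Geps 3 ε r) ^ ϑ) := by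
  refine ⟨9 / 4 * (3 ^ ϑ / ϑ + 2), fun ε hε r => ?_⟩
  have hpos := sqrt_sq_add_sq_add_pos hε.1 r
  have hlog := abs_log_sqrt_sq_add_sq_add_le hε hϑ r
  have hsqrt : √(1 ^ 2 + ε ^ 2) ≤ 2 := by
    rw [Real.sqrt_le_left (by norm_num)]
    nlinarith [hε.1, hε.2]
  have hone := Real.sqrt_nonneg (1 ^ 2 + ε ^ 2)
  have hlog1 : |Real.log (√(1 ^ 2 + ε ^ 2) + 1)| ≤ 2 := by
    rw [abs_of_nonneg (Real.log_nonneg (by linarith))]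
    linarith [Real.log_le_sub_one_of_pos (by positivity : 0 < √(1 ^ 2 + ε ^ 2) + 1)]
  have hr : 0 ≤ |r| ^ ϑ := by positivity
  have hG : 0 ≤ ((√(r ^ 2 + ε ^ 2) + r)⁻¹) ^ ϑ := by positivity
  rw [Geps_three hε.1]
  refine (abs_integral_sq_iteratedDeriv_two_Feps_three_le hε.1 r).trans ?_
  have htri := abs_sub (Real.log (√(r ^ 2 + ε ^ 2) + r)) (Real.log (√(1 ^ 2 + ε ^ 2) + 1))
  rw [mul_assoc, add_mul]
  gcongr
  refine htri.trans (add_le_add hlog (hlog1.trans (le_mul_of_one_le_right zero_le_two ?_)))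
  rw [add_assoc]
  exact le_add_of_nonneg_right (add_nonneg hr hG)
end

section
/- Let n ∈ [3,∞) be a real number. There exists a constant C < ∞ depending only on n such that for all ε ∈ (0,1) and all r ∈ ℝ one has |(F_ε²)'''(r) + 4 ((F_ε')²)'(r)| ≤ C (1 + |r|^{n−3}), where (F_ε²)''' denotes the third derivative of the function r ↦ F_ε(r)² and ((F_ε')²)' denotes the first derivative of the function r ↦ (F_ε'(r))². -/
open MeasureTheory

theorem hasDerivAt_sq_add_sq_rpow {ε : ℝ} (hε : 0 < ε) (p r : ℝ) :
    HasDerivAt (fun s : ℝ => (s ^ 2 + ε ^ 2) ^ p) (2 * p * r * (r ^ 2 + ε ^ 2) ^ (p - 1)) r := by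
  have h : HasDerivAt (fun s : ℝ => s ^ 2 + ε ^ 2) (2 * r) r := by
    simpa using (hasDerivAt_pow 2 r).add_const (ε ^ 2)
  have hq : r ^ 2 + ε ^ 2 ≠ 0 := by positivity
  convert h.rpow_const (p := p) (Or.inl hq) using 1
  ring

theorem hasDerivAt_pow_mul_sq_add_sq_rpow {ε : ℝ} (hε : 0 < ε) (k : ℕ) (p r : ℝ) :
    HasDerivAt (fun s : ℝ => s ^ k * (s ^ 2 + ε ^ 2) ^ p)
      (k * r ^ (k - 1) * (r ^ 2 + ε ^ 2) ^ p
        + r ^ k * (2 * p * r * (r ^ 2 + ε ^ 2) ^ (p - 1))) r :=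
  (hasDerivAt_pow k r).mul (hasDerivAt_sq_add_sq_rpow hε p r)

theorem rpow_mul_self_sq {q : ℝ} (hq : 0 < q) (p : ℝ) : (q ^ p) ^ 2 = q ^ (2 * p) := by
  rw [← Real.rpow_natCast, ← Real.rpow_mul hq.le]
  congr 1
  push_cast
  ring

theorem iteratedDeriv_three_Feps_sq {ε : ℝ} (hε : 0 < ε) (n r : ℝ) :
    iteratedDeriv 3 (fun s => (Feps n ε s) ^ 2) r =
      3 * n * (n - 2) * (r * (r ^ 2 + ε ^ 2) ^ (n / 2 - 2))
        + n * (n - 2) * (n - 4) * (r ^ 3 * (r ^ 2 + ε ^ 2) ^ (n / 2 - 3)) := by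
  have h0 : (fun s => (Feps n ε s) ^ 2) = fun s => (s ^ 2 + ε ^ 2) ^ (n / 2) := by
    funext s
    rw [Feps, rpow_mul_self_sq (by positivity)]
    congr 1
    ring
  have h1 : deriv (fun s : ℝ => (s ^ 2 + ε ^ 2) ^ (n / 2)) =
      fun s => n * (s ^ 1 * (s ^ 2 + ε ^ 2) ^ (n / 2 - 1)) := by
    funext s
    rw [(hasDerivAt_sq_add_sq_rpow hε _ s).deriv]
    ring
  have h2 : deriv (fun s : ℝ => n * (s ^ 1 * (s ^ 2 + ε ^ 2) ^ (n / 2 - 1))) =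
      fun s => n * (s ^ 2 + ε ^ 2) ^ (n / 2 - 1)
        + n * (n - 2) * (s ^ 2 * (s ^ 2 + ε ^ 2) ^ (n / 2 - 2)) := by
    funext s
    rw [((hasDerivAt_pow_mul_sq_add_sq_rpow hε 1 _ s).const_mul n).deriv,
      show n / 2 - 1 - 1 = n / 2 - 2 by ring]
    push_cast
    ring
  have h3 := (((hasDerivAt_sq_add_sq_rpow hε (n / 2 - 1) r).const_mul n).add
    ((hasDerivAt_pow_mul_sq_add_sq_rpow hε 2 (n / 2 - 2) r).const_mul (n * (n - 2)))).deriv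
  rw [show n / 2 - 1 - 1 = n / 2 - 2 by ring, show n / 2 - 2 - 1 = n / 2 - 3 by ring] at h3
  rw [h0, iteratedDeriv_succ, iteratedDeriv_succ, iteratedDeriv_one, h1, h2]
  refine h3.trans ?_
  push_cast
  ring

theorem deriv_deriv_Feps_sq {ε : ℝ} (hε : 0 < ε) (n r : ℝ) :
    deriv (fun s => (deriv (Feps n ε) s) ^ 2) r =
      n ^ 2 / 2 * (r * (r ^ 2 + ε ^ 2) ^ (n / 2 - 2))
        + n ^ 2 * (n - 4) / 4 * (r ^ 3 * (r ^ 2 + ε ^ 2) ^ (n / 2 - 3)) := by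
  have h1 : (fun s => (deriv (Feps n ε) s) ^ 2) =
      fun s => n ^ 2 / 4 * (s ^ 2 * (s ^ 2 + ε ^ 2) ^ (n / 2 - 2)) := by
    funext s
    have h : deriv (Feps n ε) s = 2 * (n / 4) * s * (s ^ 2 + ε ^ 2) ^ (n / 4 - 1) :=
      (hasDerivAt_sq_add_sq_rpow hε (n / 4) s).deriv
    rw [h, mul_pow, rpow_mul_self_sq (by positivity),
      show 2 * (n / 4 - 1) = n / 2 - 2 by ring]
    ring
  rw [h1, ((hasDerivAt_pow_mul_sq_add_sq_rpow hε 2 _ r).const_mul (n ^ 2 / 4)).deriv,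
    show n / 2 - 2 - 1 = n / 2 - 3 by ring]
  push_cast
  ring

theorem abs_pow_mul_rpow_le {r q : ℝ} (hq : 0 < q) (hr : r ^ 2 ≤ q) (k : ℕ) (p : ℝ) :
    |r ^ k * q ^ p| ≤ q ^ (k / 2 + p) := by
  have h : |r| ≤ q ^ (1 / 2 : ℝ) := by
    rw [← Real.sqrt_eq_rpow]
    exact Real.abs_le_sqrt hr
  rw [abs_mul, abs_pow, abs_of_pos (Real.rpow_pos_of_pos hq p), Real.rpow_add hq]
  refine mul_le_mul_of_nonneg_right ?_ (Real.rpow_nonneg hq.le p)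
  refine (pow_le_pow_left₀ (abs_nonneg r) h k).trans_eq ?_
  rw [← Real.rpow_natCast, ← Real.rpow_mul hq.le]
  congr 1
  ring

theorem sq_add_sq_rpow_half_le {ε : ℝ} (hε : ε ∈ Set.Ioo (0 : ℝ) 1) {a : ℝ} (ha : 0 ≤ a)
    (r : ℝ) : (r ^ 2 + ε ^ 2) ^ (a / 2) ≤ 2 ^ (a / 2) * (1 + |r| ^ a) := by
  obtain ⟨h0, h1⟩ := hε
  have hε2 : ε ^ 2 ≤ 1 := pow_le_one₀ h0.le h1.le
  have ha2 : 0 ≤ a / 2 := by positivity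
  have hra : 0 ≤ |r| ^ a := Real.rpow_nonneg (abs_nonneg r) a
  have h2 : (0 : ℝ) ≤ 2 ^ (a / 2) := by positivity
  rcases le_total (r ^ 2) 1 with hr | hr
  · calc (r ^ 2 + ε ^ 2) ^ (a / 2) ≤ 2 ^ (a / 2) :=
          Real.rpow_le_rpow (by positivity) (by linarith) ha2
      _ ≤ 2 ^ (a / 2) * (1 + |r| ^ a) := le_mul_of_one_le_right h2 (by linarith)
  · calc (r ^ 2 + ε ^ 2) ^ (a / 2) ≤ (2 * |r| ^ 2) ^ (a / 2) :=
          Real.rpow_le_rpow (by positivity) (by rw [sq_abs]; linarith) ha2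
      _ = 2 ^ (a / 2) * |r| ^ a := by
          rw [Real.mul_rpow (by norm_num) (by positivity), ← Real.rpow_natCast |r|,
            ← Real.rpow_mul (abs_nonneg r)]
          congr 2
          push_cast
          ring
      _ ≤ 2 ^ (a / 2) * (1 + |r| ^ a) := mul_le_mul_of_nonneg_left (by linarith) h2

/-- For `n ∈ [3,∞)` there is a constant `C` depending only on `n` such that
for all `ε ∈ (0,1)` and all `r`,
`|(F_ε²)'''(r) + 4 ((F_ε')²)'(r)| ≤ C (1 + |r|^(n-3))`. -/
theorem Feps_sq_third_deriv_bound_n_ge_three (n : ℝ) (hn : 3 ≤ n) :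
    ∃ C : ℝ, ∀ ε ∈ Set.Ioo (0 : ℝ) 1, ∀ r : ℝ,
      |iteratedDeriv 3 (fun s => (Feps n ε s) ^ 2) r
          + 4 * deriv (fun s => (deriv (Feps n ε) s) ^ 2) r|
        ≤ C * (1 + |r| ^ (n - 3)) := by
  set A : ℝ := 3 * n * (n - 2) + 2 * n ^ 2 with hA
  set B : ℝ := n * (n - 2) * (n - 4) + n ^ 2 * (n - 4) with hB
  refine ⟨(|A| + |B|) * 2 ^ ((n - 3) / 2), fun ε hε r => ?_⟩
  have hε0 : 0 < ε := hε.1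
  have hq : 0 < r ^ 2 + ε ^ 2 := by positivity
  have hr : r ^ 2 ≤ r ^ 2 + ε ^ 2 := le_add_of_nonneg_right (sq_nonneg ε)
  have h1 := abs_pow_mul_rpow_le hq hr 1 (n / 2 - 2)
  have h3 := abs_pow_mul_rpow_le hq hr 3 (n / 2 - 3)
  rw [show ((1 : ℕ) : ℝ) / 2 + (n / 2 - 2) = (n - 3) / 2 by push_cast; ring, pow_one] at h1
  rw [show ((3 : ℕ) : ℝ) / 2 + (n / 2 - 3) = (n - 3) / 2 by push_cast; ring] at h3
  have hsum : iteratedDeriv 3 (fun s => (Feps n ε s) ^ 2) r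
      + 4 * deriv (fun s => (deriv (Feps n ε) s) ^ 2) r =
      A * (r * (r ^ 2 + ε ^ 2) ^ (n / 2 - 2)) + B * (r ^ 3 * (r ^ 2 + ε ^ 2) ^ (n / 2 - 3)) := by
    rw [iteratedDeriv_three_Feps_sq hε0, deriv_deriv_Feps_sq hε0, hA, hB]
    ring
  rw [hsum]
  calc _ ≤ |A| * |r * (r ^ 2 + ε ^ 2) ^ (n / 2 - 2)|
          + |B| * |r ^ 3 * (r ^ 2 + ε ^ 2) ^ (n / 2 - 3)| := by
        rw [← abs_mul, ← abs_mul]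
        exact abs_add_le _ _
    _ ≤ |A| * (r ^ 2 + ε ^ 2) ^ ((n - 3) / 2) + |B| * (r ^ 2 + ε ^ 2) ^ ((n - 3) / 2) := by
        gcongr
    _ = (|A| + |B|) * (r ^ 2 + ε ^ 2) ^ ((n - 3) / 2) := by ring
    _ ≤ (|A| + |B|) * (2 ^ ((n - 3) / 2) * (1 + |r| ^ (n - 3))) := by
        gcongr
        exact sq_add_sq_rpow_half_le hε (sub_nonneg.2 hn) r
    _ = _ := by ring
end

section
/- Let L > 0, let σ, u : ℝ → ℝ be L-periodic with σ four times and u three times continuously differentiable, and let F : ℝ → ℝ be four times continuously differentiable. Then (1/2) ∫_0^L u'(x) · (d²/dx²)[ σ(x) F'(u(x)) · (d/dx)( σ(x) F(u(x)) ) ] dx = ∫_0^L σ(x)² ( −(1/2) (F'(u(x)))² (u''(x))² + (1/6) ((F')²)''(u(x)) (u'(x))⁴ ) dx + ∫_0^L (σ²)'(x) ( (1/16) (F²)'''(u(x)) + (5/12) ((F')²)'(u(x)) ) (u'(x))³ dx + ∫_0^L (σ²)''(x) ( (1/4) (F'(u(x)))² + (3/16) (F²)''(u(x)) ) (u'(x))²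 dx − (1/8) ∫_0^L (σ²)''''(x) F(u(x))² dx, where (F²)'' and (F²)''' denote the second and third derivatives of the function r ↦ F(r)², ((F')²)' and ((F')²)'' denote the first and second derivatives of the function r ↦ (F'(r))², and (σ²)', (σ²)'', (σ²)'''' denote derivatives of the function x ↦ σ(x)². -/
open MeasureTheory intervalIntegral

theorem ContDiff.hasDerivAt_iteratedDeriv {f : ℝ → ℝ} {n : ℕ} (hf : ContDiff ℝ n f) {k : ℕ}
    (hk : k < n) (x : ℝ) : HasDerivAt (iteratedDeriv k f) (iteratedDeriv (k + 1) f x) x := by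
  rw [iteratedDeriv_succ]
  exact (hf.differentiable_iteratedDeriv k (by exact_mod_cast hk) x).hasDerivAt

theorem Function.Periodic.iteratedDeriv {f : ℝ → ℝ} {c : ℝ} (hf : Function.Periodic f c) (k : ℕ) :
    Function.Periodic (iteratedDeriv k f) c := by
  intro x
  have h := congrFun (iteratedDeriv_comp_add_const k f c) x
  rw [← h]
  congr 1
  exact funext hf

/-- The pointwise form of the identity: with `S = σ ^ 2`, `P = F ^ 2`, `Q = (F') ^ 2` and
`A = σ F'(u) (σ F(u))'`, the two integrands differ by an exact derivative. -/
theorem hasDerivAt_correction_primitive {S u P Q A : ℝ → ℝ} (hS : ContDiff ℝ 4 S)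
    (hu : ContDiff ℝ 3 u) (hP : ContDiff ℝ 4 P) (hQ : ContDiff ℝ 3 Q)
    (hA : ∀ y, A y = (1 / 4) * iteratedDeriv 1 S y * iteratedDeriv 1 P (u y)
      + S y * Q (u y) * iteratedDeriv 1 u y) (hA2 : ContDiff ℝ 2 A) (x : ℝ) :
    HasDerivAt (fun y => (1 / 2) * iteratedDeriv 1 u y * iteratedDeriv 1 A y
        - (1 / 6) * S y * iteratedDeriv 1 Q (u y) * (iteratedDeriv 1 u y) ^ 3
        - (1 / 2) * (iteratedDeriv 1 u y) ^ 2 * iteratedDeriv 1 S y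
          * ((1 / 8) * iteratedDeriv 2 P (u y) + (1 / 2) * Q (u y))
        - (1 / 8) * iteratedDeriv 2 S y * iteratedDeriv 1 P (u y) * iteratedDeriv 1 u y
        + (1 / 8) * iteratedDeriv 3 S y * P (u y))
      ((1 / 2) * (iteratedDeriv 1 u x * iteratedDeriv 2 A x)
        - (S x * (-(1 / 2) * Q (u x) * (iteratedDeriv 2 u x) ^ 2
              + (1 / 6) * iteratedDeriv 2 Q (u x) * (iteratedDeriv 1 u x) ^ 4)
          + iteratedDeriv 1 S x * ((1 / 16) * iteratedDeriv 3 P (u x)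
              + (5 / 12) * iteratedDeriv 1 Q (u x)) * (iteratedDeriv 1 u x) ^ 3
          + iteratedDeriv 2 S x * ((1 / 4) * Q (u x)
              + (3 / 16) * iteratedDeriv 2 P (u x)) * (iteratedDeriv 1 u x) ^ 2
          - (1 / 8) * (iteratedDeriv 4 S x * P (u x)))) x := by
  have s0 : HasDerivAt S (iteratedDeriv 1 S x) x := by
    simpa using hS.hasDerivAt_iteratedDeriv (n := 4) (k := 0) (by norm_num) x
  have s1 := hS.hasDerivAt_iteratedDeriv (n := 4) (k := 1) (by norm_num) x
  have s2 := hS.hasDerivAt_iteratedDeriv (n := 4) (k := 2) (by norm_num) x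
  have s3 := hS.hasDerivAt_iteratedDeriv (n := 4) (k := 3) (by norm_num) x
  have u0 : HasDerivAt u (iteratedDeriv 1 u x) x := by
    simpa using hu.hasDerivAt_iteratedDeriv (n := 3) (k := 0) (by norm_num) x
  have u1 := hu.hasDerivAt_iteratedDeriv (n := 3) (k := 1) (by norm_num) x
  have p0 : HasDerivAt P (iteratedDeriv 1 P (u x)) (u x) := by
    simpa using hP.hasDerivAt_iteratedDeriv (n := 4) (k := 0) (by norm_num) (u x)
  have p1 := hP.hasDerivAt_iteratedDeriv (n := 4) (k := 1) (by norm_num) (u x)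
  have p2 := hP.hasDerivAt_iteratedDeriv (n := 4) (k := 2) (by norm_num) (u x)
  have q0 : HasDerivAt Q (iteratedDeriv 1 Q (u x)) (u x) := by
    simpa using hQ.hasDerivAt_iteratedDeriv (n := 3) (k := 0) (by norm_num) (u x)
  have q1 := hQ.hasDerivAt_iteratedDeriv (n := 3) (k := 1) (by norm_num) (u x)
  have a1 := hA2.hasDerivAt_iteratedDeriv (n := 2) (k := 1) (by norm_num) x
  have P0 := p0.comp x u0
  have P1 := p1.comp x u0
  have P2 := p2.comp x u0
  have Q0 := q0.comp x u0
  have Q1 := q1.comp x u0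
  have hA1 := ((((s1.const_mul (1 / 4)).mul P1).add ((s0.mul Q0).mul u1)).congr_of_eventuallyEq
    (Filter.Eventually.of_forall hA)).deriv
  rw [← iteratedDeriv_one] at hA1
  have key := ((((((u1.const_mul (1 / 2)).mul a1).sub
    (((s0.const_mul (1 / 6)).mul Q1).mul (u1.pow 3))).sub
    ((((u1.pow 2).const_mul (1 / 2)).mul s1).mul
      ((P2.const_mul (1 / 8)).add (Q0.const_mul (1 / 2))))).sub
    (((s2.const_mul (1 / 8)).mul P1).mul u1))).add ((s3.const_mul (1 / 8)).mul P0)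
  refine key.congr_deriv ?_
  simp only [hA1, Function.comp_apply, Pi.mul_apply, Pi.pow_apply, Pi.add_apply]
  norm_num
  ring

theorem integral_correction_term_identity (L : ℝ) (hL : 0 < L)
    (σ u : ℝ → ℝ) (hσ : ContDiff ℝ 4 σ) (hσper : Function.Periodic σ L)
    (hu : ContDiff ℝ 3 u) (huper : Function.Periodic u L)
    (F : ℝ → ℝ) (hF : ContDiff ℝ 4 F) :
    (1 / 2) * (∫ x in (0 : ℝ)..L, deriv u x *
        iteratedDeriv 2
          (fun y => σ y * deriv F (u y) * deriv (fun z => σ z * F (u z)) y) x)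
      = (∫ x in (0 : ℝ)..L, (σ x) ^ 2 *
            (-(1 / 2) * (deriv F (u x)) ^ 2 * (iteratedDeriv 2 u x) ^ 2
              + (1 / 6) * iteratedDeriv 2 (fun r => (deriv F r) ^ 2) (u x)
                  * (deriv u x) ^ 4))
        + (∫ x in (0 : ℝ)..L, deriv (fun y => (σ y) ^ 2) x *
            ((1 / 16) * iteratedDeriv 3 (fun r => (F r) ^ 2) (u x)
              + (5 / 12) * deriv (fun r => (deriv F r) ^ 2) (u x))
            * (deriv u x) ^ 3)
        + (∫ x in (0 : ℝ)..L, iteratedDeriv 2 (fun y => (σ y) ^ 2) x *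
            ((1 / 4) * (deriv F (u x)) ^ 2
              + (3 / 16) * iteratedDeriv 2 (fun r => (F r) ^ 2) (u x))
            * (deriv u x) ^ 2)
        - (1 / 8) * ∫ x in (0 : ℝ)..L,
            iteratedDeriv 4 (fun y => (σ y) ^ 2) x * (F (u x)) ^ 2 := by
  have hF' : ContDiff ℝ 3 (deriv F) := hF.iterate_deriv' 3 1
  have hS : ContDiff ℝ 4 (fun y => (σ y) ^ 2) := hσ.pow 2
  have hP : ContDiff ℝ 4 (fun r => (F r) ^ 2) := hF.pow 2
  have hQ : ContDiff ℝ 3 (fun r => (deriv F r) ^ 2) := hF'.pow 2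
  have hσF : ContDiff ℝ 3 (fun z => σ z * F (u z)) :=
    (hσ.of_le (by norm_num)).mul ((hF.of_le (by norm_num)).comp hu)
  have hA2 : ContDiff ℝ 2
      (fun y => σ y * deriv F (u y) * deriv (fun z => σ z * F (u z)) y) :=
    ((hσ.of_le (by norm_num)).mul
      ((hF'.of_le (by norm_num)).comp (hu.of_le (by norm_num)))).mul (hσF.iterate_deriv' 2 1)
  have dσ (y : ℝ) := (hσ.differentiable (by norm_num) y).hasDerivAt
  have du (y : ℝ) := (hu.differentiable (by norm_num) y).hasDerivAt
  have dF (r : ℝ) := (hF.differentiable (by norm_num) r).hasDerivAt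
  have hA (y : ℝ) : σ y * deriv F (u y) * deriv (fun z => σ z * F (u z)) y
      = (1 / 4) * iteratedDeriv 1 (fun y => (σ y) ^ 2) y
          * iteratedDeriv 1 (fun r => (F r) ^ 2) (u y)
        + (σ y) ^ 2 * (deriv F (u y)) ^ 2 * iteratedDeriv 1 u y := by
    have h1 : deriv (fun z => σ z * F (u z)) y = _ := ((dσ y).mul ((dF (u y)).comp y (du y))).deriv
    have h2 : deriv (fun y => (σ y) ^ 2) y = _ := ((dσ y).pow 2).deriv
    have h3 : deriv (fun r => (F r) ^ 2) (u y) = _ := ((dF (u y)).pow 2).deriv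
    simp only [iteratedDeriv_one, h1, h2, h3, Function.comp_apply]
    norm_num
    ring
  have hSper : Function.Periodic (fun y => (σ y) ^ 2) L := fun y => by simp only [hσper y]
  have hAper : Function.Periodic
      (fun y => σ y * deriv F (u y) * deriv (fun z => σ z * F (u z)) y) L := by
    have h : Function.Periodic (fun z => σ z * F (u z)) L := fun z => by
      simp only [hσper z, huper z]
    intro y
    have h' := h.iteratedDeriv 1 y
    rw [iteratedDeriv_one] at h'
    simp only [hσper y, huper y, h']
  have key := hasDerivAt_correction_primitive hS hu hP hQ hA hA2
  have cu := hu.continuous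
  have cσ := hσ.continuous
  have cF := hF.continuous
  have cF' := hF'.continuous
  have cu1 := hu.continuous_iteratedDeriv 1 (by norm_num)
  have cu2 := hu.continuous_iteratedDeriv 2 (by norm_num)
  have cA := hA2.continuous_iteratedDeriv 2 (by norm_num)
  have cS1 := hS.continuous_iteratedDeriv 1 (by norm_num)
  have cS2 := hS.continuous_iteratedDeriv 2 (by norm_num)
  have cS4 := hS.continuous_iteratedDeriv 4 (by norm_num)
  have cP2 := (hP.continuous_iteratedDeriv 2 (by norm_num)).comp cu
  have cP3 := (hP.continuous_iteratedDeriv 3 (by norm_num)).comp cu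
  have cQ1 := (hQ.continuous_iteratedDeriv 1 (by norm_num)).comp cu
  have cQ2 := (hQ.continuous_iteratedDeriv 2 (by norm_num)).comp cu
  simp only [Function.comp_def] at cP2 cP3 cQ1 cQ2
  have ftc := integral_eq_sub_of_hasDerivAt (a := 0) (b := L) (fun x _ => key x)
    (Continuous.intervalIntegrable (by fun_prop) _ _)
  have hper {f : ℝ → ℝ} (hf : Function.Periodic f L) : f L = f 0 := hf.eq
  rw [hper (huper.iteratedDeriv 1), hper (hAper.iteratedDeriv 1), hper huper, hper hσper,
    hper (hSper.iteratedDeriv 1), hper (hSper.iteratedDeriv 2), hper (hSper.iteratedDeriv 3),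
    sub_self,
    integral_sub (Continuous.intervalIntegrable (by fun_prop) _ _)
      (Continuous.intervalIntegrable (by fun_prop) _ _),
    integral_sub (Continuous.intervalIntegrable (by fun_prop) _ _)
      (Continuous.intervalIntegrable (by fun_prop) _ _),
    integral_add (Continuous.intervalIntegrable (by fun_prop) _ _)
      (Continuous.intervalIntegrable (by fun_prop) _ _),
    integral_add (Continuous.intervalIntegrable (by fun_prop) _ _)
      (Continuous.intervalIntegrable (by fun_prop) _ _),
    intervalIntegral.integral_const_mul, intervalIntegral.integral_const_mul] at ftc
  simp only [iteratedDeriv_one] at ftc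
  exact sub_eq_zero.mp ftc
end
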